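/- arXiv:2104.07482 — 2 statements merged into one kernel-verified Lean document; each statement's English description precedes it below -/
import Mathlib

section
/- Let μ be a Radon measure on ℝ^d admitting (p,q) Fourier restriction with q = p' and p > 1. Then μ is absolutely continuous with respect to the Lebesgue measure L^d. -/
open MeasureTheory Metric Filter
open scoped FourierTransform ENNReal SchwartzMap

noncomputable section

/-- `ℝ^d` as a Euclidean space. -/
abbrev Euc (d : ℕ) := EuclideanSpace ℝ (Fin d)

/-- The measure `μ` admits `(p,q)` Fourier restriction with constant `C`:
`‖f̂‖_{L^q(μ)} ≤ C ‖f‖_{L^p(ℝ^d)}` for all Schwartz functions `f`. -/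
def HasRestriction {d : ℕ} (μ : Measure (Euc d)) (p q C : ℝ) : Prop :=
  ∀ f : 𝓢(Euc d, ℂ),
    eLpNorm (𝓕 (f : Euc d → ℂ)) (ENNReal.ofReal q) μ ≤
      ENNReal.ofReal C * eLpNorm (f : Euc d → ℂ) (ENNReal.ofReal p) volume

/-- A measure dominated on closed balls by a finite multiple of Lebesgue measure is absolutely
continuous. -/
theorem absolutelyContinuous_of_closedBall_le {d : ℕ} {μ : Measure (Euc d)} {K : ℝ≥0∞}
    (hK : K ≠ ∞) (h : ∀ x r, 0 < r → μ (closedBall x r) ≤ K * volume (closedBall x r)) :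
    μ ≪ (volume : Measure (Euc d)) := by
  intro s hs
  have key (ε : ℝ≥0∞) (hε : ε ≠ 0) : μ s ≤ K * ε := by
    obtain ⟨t, r, ht, -, hr, hst, hsum⟩ := Besicovitch.exists_closedBall_covering_tsum_measure_le
      (volume : Measure (Euc d)) hε (fun _ ↦ Set.Ioi 0) s fun x _ δ hδ ↦
        ⟨δ / 2, half_pos hδ, half_pos hδ, half_lt_self hδ⟩
    calc μ s ≤ μ (⋃ x ∈ t, closedBall x (r x)) := measure_mono hst
      _ ≤ ∑' x : t, μ (closedBall (x : Euc d) (r x)) := measure_biUnion_le _ ht _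
      _ ≤ ∑' x : t, K * volume (closedBall (x : Euc d) (r x)) :=
        ENNReal.tsum_le_tsum fun x ↦ h _ _ (hr x x.2)
      _ = K * ∑' x : t, volume (closedBall (x : Euc d) (r x)) := ENNReal.tsum_mul_left
      _ ≤ K * ε := by
        gcongr
        simpa [hs] using hsum
  have hlim : Tendsto (fun ε : ℝ≥0∞ ↦ K * ε) (nhdsWithin 0 (Set.Ioi 0)) (nhds 0) := by
    have := (ENNReal.continuous_const_mul hK).tendsto 0
    rw [mul_zero] at this
    exact this.mono_left nhdsWithin_le_nhds
  have hle : μ s ≤ 0 := ge_of_tendsto hlim <| by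
    filter_upwards [self_mem_nhdsWithin] with ε hε using key ε (ne_of_gt hε)
  exact le_antisymm hle zero_le

/-- Affine rescaling `ξ ↦ ψ (r⁻¹ • (ξ - x))` of a Schwartz function. -/
def schwartzRescale {d : ℕ} (ψ : 𝓢(Euc d, ℂ)) (x : Euc d) {r : ℝ} (hr : 0 < r) :
    𝓢(Euc d, ℂ) :=
  SchwartzMap.compCLMOfAntilipschitz (g := fun ξ : Euc d ↦ r⁻¹ • (ξ - x)) (K := r.toNNReal) ℂ
    (by fun_prop)
    (AntilipschitzWith.of_le_mul_dist fun ξ η ↦ by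
      rw [dist_smul₀, Real.coe_toNNReal _ hr.le, Real.norm_of_nonneg (inv_nonneg.2 hr.le),
        dist_sub_right, mul_inv_cancel_left₀ hr.ne']) ψ

theorem schwartzRescale_apply {d : ℕ} (ψ : 𝓢(Euc d, ℂ)) (x : Euc d) {r : ℝ} (hr : 0 < r)
    (ξ : Euc d) : schwartzRescale ψ x hr ξ = ψ (r⁻¹ • (ξ - x)) := rfl

theorem norm_fourierInv_schwartzRescale {d : ℕ} (ψ : 𝓢(Euc d, ℂ)) (x : Euc d) {r : ℝ}
    (hr : 0 < r) (y : Euc d) :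
    ‖(𝓕⁻ (schwartzRescale ψ x hr)) y‖ = r ^ d * ‖(𝓕⁻ ψ) (r • y)‖ := by
  simp only [SchwartzMap.fourierInv_coe, Real.fourierInv_eq', schwartzRescale_apply]
  rw [← integral_add_right_eq_self _ x]
  have hshift (ξ : Euc d) :
      Complex.exp (↑(2 * Real.pi * inner ℝ (ξ + x) y) * Complex.I) •
          ψ (r⁻¹ • (ξ + x - x)) =
        Complex.exp (↑(2 * Real.pi * inner ℝ x y) * Complex.I) *
          (fun η : Euc d ↦ Complex.exp (↑(2 * Real.pi * inner ℝ η (r • y)) * Complex.I) •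
            ψ η) (r⁻¹ • ξ) := by
    simp only [add_sub_cancel_right, smul_eq_mul, inner_smul_left, inner_smul_right,
      inner_add_left, RCLike.conj_to_real]
    rw [mul_inv_cancel_left₀ hr.ne', ← mul_assoc, ← Complex.exp_add]
    congr 2
    push_cast
    ring
  rw [integral_congr_ae (Eventually.of_forall hshift), integral_const_mul,
    Measure.integral_comp_smul volume
      (fun η : Euc d ↦ Complex.exp (↑(2 * Real.pi * inner ℝ η (r • y)) * Complex.I) • ψ η) r⁻¹,
    norm_mul, Complex.norm_exp_ofReal_mul_I,
    one_mul, norm_smul, finrank_euclideanSpace_fin]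
  congr 1
  rw [Real.norm_eq_abs, abs_abs, inv_pow, inv_inv, abs_of_pos (pow_pos hr d)]

theorem eLpNorm_comp_smul {d : ℕ} {f : Euc d → ℂ} (hf : Continuous f) {r : ℝ} (hr : 0 < r)
    {p : ℝ≥0∞} (hp : p ≠ ∞) :
    eLpNorm (fun y ↦ f (r • y)) p volume =
      ENNReal.ofReal ((r ^ d)⁻¹) ^ (1 / p).toReal * eLpNorm f p volume := by
  have h := eLpNorm_map_measure (p := p) (μ := (volume : Measure (Euc d)))
    (f := fun y ↦ r • y) (g := f) hf.aestronglyMeasurable (by fun_prop)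
  rw [Measure.map_addHaar_smul _ hr.ne', eLpNorm_smul_measure_of_ne_top hp,
    finrank_euclideanSpace_fin, abs_of_pos (inv_pos.2 (pow_pos hr d)), smul_eq_mul] at h
  exact h.symm

theorem eLpNorm_fourierInv_schwartzRescale {d : ℕ} (ψ : 𝓢(Euc d, ℂ)) (x : Euc d) {r : ℝ}
    (hr : 0 < r) {p : ℝ} (hp : 0 < p) :
    eLpNorm (⇑(𝓕⁻ (schwartzRescale ψ x hr) : 𝓢(Euc d, ℂ))) (ENNReal.ofReal p) volume =
      ENNReal.ofReal (r ^ d) ^ (1 - 1 / p) * eLpNorm (⇑(𝓕⁻ ψ : 𝓢(Euc d, ℂ))) (ENNReal.ofReal p) volume := by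
  have hrd : 0 < r ^ d := pow_pos hr d
  have h1 : eLpNorm (⇑(𝓕⁻ (schwartzRescale ψ x hr) : 𝓢(Euc d, ℂ))) (ENNReal.ofReal p) volume =
      eLpNorm ((r ^ d) • fun y ↦ (𝓕⁻ ψ) (r • y)) (ENNReal.ofReal p) volume := by
    refine eLpNorm_congr_norm_ae (Eventually.of_forall fun y ↦ ?_)
    rw [norm_fourierInv_schwartzRescale, Pi.smul_apply, norm_smul,
      Real.norm_of_nonneg hrd.le]
  rw [h1, eLpNorm_const_smul, eLpNorm_comp_smul (𝓕⁻ ψ : 𝓢(Euc d, ℂ)).continuous hr ENNReal.ofReal_ne_top,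
    Real.enorm_of_nonneg hrd.le, ← mul_assoc, one_div, ENNReal.toReal_inv,
    ENNReal.toReal_ofReal hp.le, ENNReal.ofReal_inv_of_pos hrd, ENNReal.inv_rpow,
    ← ENNReal.rpow_neg, sub_eq_add_neg, one_div,
    ENNReal.rpow_add _ _ (by simpa using hrd) ENNReal.ofReal_ne_top, ENNReal.rpow_one]

/-- A Schwartz function equal to `1` on the closed unit ball. -/
theorem exists_schwartz_eq_one_on_closedBall (d : ℕ) :
    ∃ ψ : 𝓢(Euc d, ℂ), ∀ ξ ∈ closedBall (0 : Euc d) 1, ψ ξ = 1 := by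
  let b : ContDiffBump (0 : Euc d) := ⟨1, 2, one_pos, one_lt_two⟩
  have hb : HasCompactSupport fun ξ ↦ (b ξ : ℂ) :=
    b.hasCompactSupport.comp_left (g := Complex.ofReal) Complex.ofReal_zero
  refine ⟨hb.toSchwartzMap (Complex.ofRealCLM.contDiff.comp b.contDiff), fun ξ hξ ↦ ?_⟩
  change (b ξ : ℂ) = 1
  rw [b.one_of_mem_closedBall hξ, Complex.ofReal_one]

/-- Restriction with exponents `(p, p')` controls the measure of balls by their volume. -/
theorem HasRestriction.exists_measure_closedBall_le {d : ℕ} {p q C : ℝ} (hp : 1 < p)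
    (hpq : q = p / (p - 1)) {μ : Measure (Euc d)} (h : HasRestriction μ p q C) :
    ∃ M : ℝ≥0∞, M ≠ ∞ ∧
      ∀ x r, 0 < r → μ (closedBall x r) ≤ M * ENNReal.ofReal (r ^ d) := by
  have hp0 : 0 < p := one_pos.trans hp
  have hp1 : 0 < p - 1 := sub_pos.2 hp
  have hq : 0 < q := hpq ▸ div_pos hp0 hp1
  have hexp : (1 - 1 / p) * q = 1 := by
    rw [hpq]
    field_simp
  obtain ⟨ψ, hψ⟩ := exists_schwartz_eq_one_on_closedBall d
  have hfin : eLpNorm (⇑(𝓕⁻ ψ : 𝓢(Euc d, ℂ))) (ENNReal.ofReal p) volume ≠ ∞ :=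
    (SchwartzMap.eLpNorm_lt_top (𝓕⁻ ψ : 𝓢(Euc d, ℂ)) (ENNReal.ofReal p) volume).ne
  refine ⟨(ENNReal.ofReal C * eLpNorm (⇑(𝓕⁻ ψ : 𝓢(Euc d, ℂ))) (ENNReal.ofReal p) volume) ^ q,
    ENNReal.rpow_ne_top_of_nonneg hq.le
      (ENNReal.mul_ne_top ENNReal.ofReal_ne_top hfin), fun x r hr ↦ ?_⟩
  let φ : 𝓢(Euc d, ℂ) := schwartzRescale ψ x hr
  have hrestr : eLpNorm φ (ENNReal.ofReal q) μ ≤ ENNReal.ofReal C *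
      (ENNReal.ofReal (r ^ d) ^ (1 - 1 / p) *
        eLpNorm (⇑(𝓕⁻ ψ : 𝓢(Euc d, ℂ))) (ENNReal.ofReal p) volume) := by
    have hF := h (𝓕⁻ φ)
    rw [← SchwartzMap.fourier_coe, FourierTransform.fourier_fourierInv_eq] at hF
    rwa [eLpNorm_fourierInv_schwartzRescale ψ x hr hp0] at hF
  have hcheb := mul_meas_ge_le_pow_eLpNorm' μ (p := ENNReal.ofReal q) (by simpa using hq)
    ENNReal.ofReal_ne_top φ.continuous.aestronglyMeasurable 1
  rw [ENNReal.one_rpow, one_mul, ENNReal.toReal_ofReal hq.le] at hcheb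
  calc μ (closedBall x r) ≤ μ {ξ | 1 ≤ ‖φ ξ‖ₑ} := measure_mono fun ξ hξ ↦ by
        have : r⁻¹ • (ξ - x) ∈ closedBall (0 : Euc d) 1 := by
          rw [mem_closedBall, dist_eq_norm] at hξ
          rw [mem_closedBall_zero_iff, norm_smul, Real.norm_of_nonneg (inv_nonneg.2 hr.le)]
          exact (inv_mul_le_one₀ hr).2 hξ
        change 1 ≤ ‖φ ξ‖ₑ
        rw [schwartzRescale_apply, hψ _ this, enorm_one]
    _ ≤ eLpNorm φ (ENNReal.ofReal q) μ ^ q := hcheb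
    _ ≤ (ENNReal.ofReal C * (ENNReal.ofReal (r ^ d) ^ (1 - 1 / p) *
          eLpNorm (⇑(𝓕⁻ ψ : 𝓢(Euc d, ℂ))) (ENNReal.ofReal p) volume)) ^ q := by gcongr
    _ = (ENNReal.ofReal C * eLpNorm (⇑(𝓕⁻ ψ : 𝓢(Euc d, ℂ))) (ENNReal.ofReal p) volume) ^ q *
          ENNReal.ofReal (r ^ d) := by
      rw [mul_left_comm, mul_comm, ENNReal.mul_rpow_of_nonneg _ _ hq.le, ← ENNReal.rpow_mul,
        hexp, ENNReal.rpow_one]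

/-- If a Radon measure `μ` admits `(p,q)` restriction with `q = p'` and `p > 1`,
then `μ` is absolutely continuous with respect to Lebesgue measure. -/
theorem restriction_conj_exponent_absolutelyContinuous (d : ℕ) (p q C : ℝ) (hp : 1 < p)
    (hpq : q = p / (p - 1)) (μ : Measure (Euc d)) [IsLocallyFiniteMeasure μ]
    (h : HasRestriction μ p q C) :
    μ ≪ (volume : Measure (Euc d)) := by
  obtain ⟨M, hM, hball⟩ := h.exists_measure_closedBall_le hp hpq
  have hV : volume (ball (0 : Euc d) 1) ≠ 0 := (measure_ball_pos _ _ one_pos).ne'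
  refine absolutelyContinuous_of_closedBall_le (K := M / volume (ball (0 : Euc d) 1))
    (ENNReal.div_ne_top hM hV) fun x r hr ↦ (hball x r hr).trans_eq ?_
  rw [Measure.addHaar_closedBall _ _ hr.le, finrank_euclideanSpace_fin, mul_left_comm,
    ENNReal.div_mul_cancel hV measure_ball_lt_top.ne, mul_comm]

end
end

section
/- Let η = θ ⊗ H^k⌞V with V a k-dimensional subspace of ℝ^d and θ a Radon measure on V^⊥. If η admits (p,q) Fourier restriction, then θ, viewed as a measure on the Euclidean space V^⊥, admits the same (p,q) restriction estimate within V^⊥ (with a possibly different constant). -/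
open MeasureTheory Metric Filter
open scoped FourierTransform ENNReal SchwartzMap

noncomputable section

/-- The product measure `θ ⊗ H^k⌞V` on `ℝ^d = V ⊕ V^⊥`, where `θ` is a measure on `V^⊥`. -/
def tensorWith {d : ℕ} (V : Submodule ℝ (Euc d)) (θ : Measure ↥Vᗮ) (k : ℕ) :
    Measure (Euc d) :=
  Measure.map (fun p : Euc d × Euc d => p.1 + p.2)
    ((Measure.map (Subtype.val : ↥Vᗮ → Euc d) θ).prod
      ((μH[(k : ℝ)] : Measure (Euc d)).restrict (V : Set (Euc d))))

theorem SchwartzMap.norm_iteratedFDeriv_comp_clm_le {E F : Type*} [NormedAddCommGroup E]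
    [NormedSpace ℝ E] [NormedAddCommGroup F] [NormedSpace ℝ F] (f : 𝓢(F, ℂ)) (L : E →L[ℝ] F)
    (n : ℕ) (x : E) :
    ‖iteratedFDeriv ℝ n (f ∘ L) x‖ ≤ ‖iteratedFDeriv ℝ n f (L x)‖ * ‖L‖ ^ n := by
  rw [L.iteratedFDeriv_comp_right (f.smooth ⊤) x (by exact_mod_cast le_top)]
  simpa using ContinuousMultilinearMap.norm_compContinuousLinearMap_le
    (iteratedFDeriv ℝ n f (L x)) (fun _ => L)

/-- The Schwartz function `x ↦ f (A x) * g (B x)`, for linear maps `A` and `B` that jointly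
control the norm. -/
def SchwartzMap.compMulComp {E F G : Type*} [NormedAddCommGroup E] [NormedSpace ℝ E]
    [NormedAddCommGroup F] [NormedSpace ℝ F] [NormedAddCommGroup G] [NormedSpace ℝ G]
    (A : E →L[ℝ] F) (B : E →L[ℝ] G) (hAB : ∀ x, ‖x‖ ≤ ‖A x‖ + ‖B x‖)
    (f : 𝓢(F, ℂ)) (g : 𝓢(G, ℂ)) : 𝓢(E, ℂ) where
  toFun x := f (A x) * g (B x)
  smooth' := by
    have hf := (f.smooth ⊤).comp A.contDiff
    have hg := (g.smooth ⊤).comp B.contDiff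
    exact hf.mul hg
  decay' m n := by
    set Cf := 2 ^ m * ((Finset.Iic (m, n)).sup fun j => SchwartzMap.seminorm ℝ j.1 j.2) f
    set Cg := 2 ^ m * ((Finset.Iic (m, n)).sup fun j => SchwartzMap.seminorm ℝ j.1 j.2) g
    refine ⟨∑ i ∈ Finset.range (n + 1),
      (n.choose i : ℝ) * (Cf * ‖A‖ ^ i) * (Cg * ‖B‖ ^ (n - i)), fun x => ?_⟩
    have hle := norm_iteratedFDeriv_mul_le (𝕜 := ℝ) (N := (⊤ : ℕ∞))
      ((f.smooth ⊤).comp A.contDiff) ((g.smooth ⊤).comp B.contDiff) x (n := n)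
      (by exact_mod_cast le_top)
    refine (mul_le_mul_of_nonneg_left hle (by positivity)).trans ?_
    rw [Finset.mul_sum]
    refine Finset.sum_le_sum fun i hi => ?_
    have hi' : i ≤ n := Nat.lt_succ_iff.mp (Finset.mem_range.mp hi)
    have hF : (1 + ‖A x‖) ^ m * ‖iteratedFDeriv ℝ i f (A x)‖ ≤ Cf :=
      SchwartzMap.one_add_le_sup_seminorm_apply (𝕜 := ℝ) (m := (m, n)) le_rfl hi' f (A x)
    have hG : (1 + ‖B x‖) ^ m * ‖iteratedFDeriv ℝ (n - i) g (B x)‖ ≤ Cg :=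
      SchwartzMap.one_add_le_sup_seminorm_apply (𝕜 := ℝ) (m := (m, n)) le_rfl
        (Nat.sub_le n i) g (B x)
    have hx : ‖x‖ ^ m ≤ (1 + ‖A x‖) ^ m * (1 + ‖B x‖) ^ m := by
      rw [← mul_pow]
      refine pow_le_pow_left₀ (norm_nonneg x) ((hAB x).trans ?_) m
      nlinarith [norm_nonneg (A x), norm_nonneg (B x),
        mul_nonneg (norm_nonneg (A x)) (norm_nonneg (B x))]
    calc ‖x‖ ^ m * (n.choose i * ‖iteratedFDeriv ℝ i (f ∘ A) x‖ *
          ‖iteratedFDeriv ℝ (n - i) (g ∘ B) x‖)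
        ≤ ((1 + ‖A x‖) ^ m * (1 + ‖B x‖) ^ m) * (n.choose i *
          (‖iteratedFDeriv ℝ i f (A x)‖ * ‖A‖ ^ i) *
          (‖iteratedFDeriv ℝ (n - i) g (B x)‖ * ‖B‖ ^ (n - i))) := by
          gcongr
          · exact f.norm_iteratedFDeriv_comp_clm_le A i x
          · exact g.norm_iteratedFDeriv_comp_clm_le B (n - i) x
      _ = n.choose i * (((1 + ‖A x‖) ^ m * ‖iteratedFDeriv ℝ i f (A x)‖) * ‖A‖ ^ i) *
          (((1 + ‖B x‖) ^ m * ‖iteratedFDeriv ℝ (n - i) g (B x)‖) * ‖B‖ ^ (n - i)) := by ring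
      _ ≤ _ := by gcongr

@[simp]
theorem SchwartzMap.compMulComp_apply {E F G : Type*} [NormedAddCommGroup E] [NormedSpace ℝ E]
    [NormedAddCommGroup F] [NormedSpace ℝ F] [NormedAddCommGroup G] [NormedSpace ℝ G]
    (A : E →L[ℝ] F) (B : E →L[ℝ] G) (hAB : ∀ x, ‖x‖ ≤ ‖A x‖ + ‖B x‖)
    (f : 𝓢(F, ℂ)) (g : 𝓢(G, ℂ)) (x : E) :
    SchwartzMap.compMulComp A B hAB f g x = f (A x) * g (B x) :=
  rfl

theorem eLpNorm_prod_mul {α β : Type*} [MeasurableSpace α] [MeasurableSpace β]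
    {μ : Measure α} {ν : Measure β} [SFinite ν] {f : α → ℂ} {g : β → ℂ}
    (hf : AEStronglyMeasurable f μ) (hg : AEStronglyMeasurable g ν) {p : ℝ≥0∞}
    (hp : p ≠ 0) (hp' : p ≠ ∞) :
    eLpNorm (fun z : α × β => f z.1 * g z.2) p (μ.prod ν) = eLpNorm f p μ * eLpNorm g p ν := by
  simp only [eLpNorm_eq_lintegral_rpow_enorm_toReal hp hp', enorm_mul,
    ENNReal.mul_rpow_of_nonneg _ _ ENNReal.toReal_nonneg]
  rw [lintegral_prod_mul (hf.enorm.pow_const _) (hg.enorm.pow_const _),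
    ENNReal.mul_rpow_of_nonneg _ _ (by positivity)]

theorem Submodule.norm_le_norm_orthogonalProjectionOnto_add {E : Type*} [NormedAddCommGroup E]
    [InnerProductSpace ℝ E] (V : Submodule ℝ E) [V.HasOrthogonalProjection] (x : E) :
    ‖x‖ ≤ ‖V.orthogonalProjectionOnto x‖ + ‖Vᗮ.orthogonalProjectionOnto x‖ := by
  conv_lhs => rw [← V.starProjection_add_starProjection_orthogonal x]
  exact norm_add_le _ _

section Orthogonal

variable {E : Type*} [NormedAddCommGroup E] [InnerProductSpace ℝ E] [FiniteDimensional ℝ E]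
  [MeasurableSpace E] [BorelSpace E] (V : Submodule ℝ E)

theorem Submodule.measurePreserving_orthogonalProjectionOnto_prod :
    MeasurePreserving
      (fun x : E => (V.orthogonalProjectionOnto x, Vᗮ.orthogonalProjectionOnto x)) := by
  have h := (WithLp.volume_preserving_ofLp V Vᗮ).comp V.orthogonalDecomposition.measurePreserving
  convert h using 1
  ext x <;> simp

theorem Submodule.measurableEmbedding_orthogonalProjectionOnto_prod :
    MeasurableEmbedding
      (fun x : E => (V.orthogonalProjectionOnto x, Vᗮ.orthogonalProjectionOnto x)) := by
  have h := (MeasurableEquiv.toLp 2 (V × Vᗮ)).symm.measurableEmbedding.comp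
    V.orthogonalDecomposition.toHomeomorph.measurableEmbedding
  convert h using 1
  ext x <;> simp

/-- The tensor product of Schwartz functions on `V` and on `Vᗮ`. -/
def Submodule.schwartzTensor (f : 𝓢(V, ℂ)) (g : 𝓢(Vᗮ, ℂ)) : 𝓢(E, ℂ) :=
  SchwartzMap.compMulComp V.orthogonalProjectionOnto Vᗮ.orthogonalProjectionOnto
    V.norm_le_norm_orthogonalProjectionOnto_add f g

theorem Submodule.eLpNorm_schwartzTensor (f : 𝓢(V, ℂ)) (g : 𝓢(Vᗮ, ℂ)) {p : ℝ≥0∞}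
    (hp : p ≠ 0) (hp' : p ≠ ∞) :
    eLpNorm (V.schwartzTensor f g) p volume = eLpNorm f p volume * eLpNorm g p volume := by
  rw [← eLpNorm_prod_mul f.continuous.aestronglyMeasurable g.continuous.aestronglyMeasurable
    hp hp']
  have hcont : Continuous fun z : V × Vᗮ => f z.1 * g z.2 :=
    (f.continuous.comp continuous_fst).mul (g.continuous.comp continuous_snd)
  rw [← Measure.volume_eq_prod, ← eLpNorm_comp_measurePreserving hcont.aestronglyMeasurable
    V.measurePreserving_orthogonalProjectionOnto_prod]
  rfl

theorem Submodule.fourier_schwartzTensor (f : 𝓢(V, ℂ)) (g : 𝓢(Vᗮ, ℂ)) (v : V) (w : Vᗮ) :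
    𝓕 (V.schwartzTensor f g : E → ℂ) (v + w) = 𝓕 (f : V → ℂ) v * 𝓕 (g : Vᗮ → ℂ) w := by
  simp only [Real.fourier_eq]
  rw [← integral_prod_mul, ← Measure.volume_eq_prod,
    ← V.measurePreserving_orthogonalProjectionOnto_prod.integral_comp
      V.measurableEmbedding_orthogonalProjectionOnto_prod]
  congr with x
  have hv : inner ℝ x (v : E) = inner ℝ (V.orthogonalProjectionOnto x) v := by
    simp
  have hw : inner ℝ x (w : E) = inner ℝ (Vᗮ.orthogonalProjectionOnto x) w := by
    simp
  rw [inner_add_right, hv, hw, neg_add, AddChar.map_add_eq_mul]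
  simp only [Submodule.schwartzTensor, SchwartzMap.compMulComp_apply, Circle.smul_def,
    Circle.coe_mul, smul_eq_mul]
  ring

end Orthogonal

theorem SchwartzMap.exists_fourier_ne_zero (E : Type*) [NormedAddCommGroup E]
    [InnerProductSpace ℝ E] [FiniteDimensional ℝ E] [MeasurableSpace E] [BorelSpace E] :
    ∃ f : 𝓢(E, ℂ), 𝓕 f ≠ 0 := by
  obtain ⟨u, -, hu, hu', -, hu1⟩ :=
    exists_contDiff_tsupport_subset (n := ⊤) (Filter.univ_mem : Set.univ ∈ nhds (0 : E))
  have hsupp : HasCompactSupport (fun x => (u x : ℂ)) := hu.comp_left (g := Complex.ofReal) rfl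
  let f : 𝓢(E, ℂ) := hsupp.toSchwartzMap (Complex.ofRealCLM.contDiff.comp hu')
  refine ⟨f, fun h => ?_⟩
  have hf : f = 0 :=
    (FourierTransform.fourierCLE ℂ 𝓢(E, ℂ)).injective (h.trans (map_zero _).symm)
  have h0 : f 0 = 1 := by
    change (u 0 : ℂ) = 1
    simp [hu1]
  simp [hf] at h0

theorem tensorWith_eq_map {d k : ℕ} (V : Submodule ℝ (Euc d)) (θ : Measure Vᗮ) [SFinite θ]
    [SFinite (μH[(k : ℝ)] : Measure V)] :
    tensorWith V θ k =
      Measure.map (fun z : Vᗮ × V => (z.1 : Euc d) + z.2) (θ.prod μH[(k : ℝ)]) := by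
  have hrange : (μH[(k : ℝ)] : Measure (Euc d)).restrict V =
      Measure.map (Subtype.val : V → Euc d) μH[(k : ℝ)] := by
    rw [isometry_subtype_coe.map_hausdorffMeasure (Or.inl k.cast_nonneg), Subtype.range_coe]
  rw [tensorWith, hrange, Measure.map_prod_map _ _ measurable_subtype_coe measurable_subtype_coe,
    Measure.map_map (by fun_prop) (by fun_prop)]
  rfl

/-- If `η = θ ⊗ H^k⌞V` admits `(p,q)` Fourier restriction, then `θ`, viewed as a measure on
the Euclidean space `V^⊥`, admits the same `(p,q)` restriction estimate within `V^⊥`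
(with a possibly different constant). -/
theorem tensor_restriction_factor (d k : ℕ) (V : Submodule ℝ (Euc d))
    (hV : Module.finrank ℝ V = k) (θ : Measure ↥Vᗮ) [IsLocallyFiniteMeasure θ]
    (p q C : ℝ) (hp : 1 ≤ p) (hq : 1 ≤ q)
    (h : HasRestriction (tensorWith V θ k) p q C) :
    ∃ C' : ℝ, ∀ g : 𝓢(↥Vᗮ, ℂ),
      eLpNorm (𝓕 (g : ↥Vᗮ → ℂ)) (ENNReal.ofReal q) θ ≤
        ENNReal.ofReal C' * eLpNorm (g : ↥Vᗮ → ℂ) (ENNReal.ofReal p) volume := by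
  subst hV
  have hp0 : ENNReal.ofReal p ≠ 0 := by simp; linarith
  have hq0 : ENNReal.ofReal q ≠ 0 := by simp; linarith
  obtain ⟨f, hf⟩ := SchwartzMap.exists_fourier_ne_zero V
  let F : 𝓢(V, ℂ) := 𝓕 f
  set ν : Measure V := μH[(Module.finrank ℝ V : ℝ)]
  set a := eLpNorm F (ENNReal.ofReal q) ν with ha
  set M := eLpNorm f (ENNReal.ofReal p) volume
  have ha0 : a ≠ 0 := by
    rw [ha, Ne, eLpNorm_eq_zero_iff F.continuous.aestronglyMeasurable hq0]
    intro h0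
    exact hf (DFunLike.coe_injective
      ((F.continuous.ae_eq_iff_eq ν continuous_zero).mp h0))
  have ha_top : a ≠ ∞ := (F.eLpNorm_lt_top _ ν).ne
  have hM_top : M ≠ ∞ := (f.eLpNorm_lt_top _ volume).ne
  refine ⟨(ENNReal.ofReal C * M / a).toReal, fun g => ?_⟩
  let G : 𝓢(Vᗮ, ℂ) := 𝓕 g
  have hmain := h (V.schwartzTensor f g)
  have hcont : Continuous (𝓕 (V.schwartzTensor f g : Euc d → ℂ)) :=
    (𝓕 (V.schwartzTensor f g) : 𝓢(Euc d, ℂ)).continuous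
  rw [V.eLpNorm_schwartzTensor f g hp0 ENNReal.ofReal_ne_top, tensorWith_eq_map,
    eLpNorm_map_measure hcont.aestronglyMeasurable (by fun_prop)] at hmain
  have hfun : (𝓕 (V.schwartzTensor f g : Euc d → ℂ)) ∘ (fun z : Vᗮ × V => (z.1 : Euc d) + z.2) =
      fun z => G z.1 * F z.2 := by
    ext z
    rw [Function.comp_apply, add_comm, V.fourier_schwartzTensor, mul_comm]
    rfl
  rw [hfun, eLpNorm_prod_mul G.continuous.aestronglyMeasurable
    F.continuous.aestronglyMeasurable hq0 ENNReal.ofReal_ne_top] at hmain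
  rw [ENNReal.ofReal_toReal
    (ENNReal.div_ne_top (ENNReal.mul_ne_top ENNReal.ofReal_ne_top hM_top) ha0),
    ← ENNReal.mul_div_right_comm, ENNReal.le_div_iff_mul_le (Or.inl ha0) (Or.inl ha_top),
    mul_assoc]
  exact hmain

end
end
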